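/- Given a three-dimensional conformal structure on U ⊆ ℝ^V for a tetrahedron collection 𝒯, let f : (−ε, ε) → U be a smooth curve and let EHR(t) = Σ_{edges {i,j}} (2π − Σ_{{i,j,k,l} ∈ 𝒯} β_{ij,kl}) ℓ_ij evaluated at f(t). Then at t = 0, (d/dt) EHR = Σ_{i ∈ V} K_i f_i′. -/

import Mathlib

open Finset

/-- The angle at the vertex of a Euclidean triangle whose two adjacent sides have
lengths `a`, `b` and whose opposite side has length `c` (law of cosines). -/
noncomputable def triAngle (a b c : ℝ) : ℝ :=
  Real.arccos ((a ^ 2 + b ^ 2 - c ^ 2) / (2 * a * b))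

/-- The dihedral angle `β_{ij,kl}` at the edge `{i,j}` of the tetrahedron `{i,j,k,l}`
with edge lengths `a = ℓ_ij`, `b = ℓ_ik`, `c = ℓ_il`, `p = ℓ_jk`, `q = ℓ_jl`,
`r = ℓ_kl`. -/
noncomputable def dihedralAngle (a b c p q r : ℝ) : ℝ :=
  Real.arccos ((Real.cos (triAngle b c r)
      - Real.cos (triAngle a b p) * Real.cos (triAngle a c q)) /
    (Real.sin (triAngle a b p) * Real.sin (triAngle a c q)))

/-- The Cayley–Menger determinant of a tetrahedron with edge lengths
`a = ℓ₁₂`, `b = ℓ₁₃`, `c = ℓ₁₄`, `p = ℓ₂₃`, `q = ℓ₂₄`, `r = ℓ₃₄`. -/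
noncomputable def cmDet (a b c p q r : ℝ) : ℝ :=
  Matrix.det !![(0 : ℝ), 1, 1, 1, 1;
    1, 0, a ^ 2, b ^ 2, c ^ 2;
    1, a ^ 2, 0, p ^ 2, q ^ 2;
    1, b ^ 2, p ^ 2, 0, r ^ 2;
    1, c ^ 2, q ^ 2, r ^ 2, 0]

/-- `{i, j}` is an edge of the tetrahedron collection `𝒯`. -/
def IsEdge {V : Type*} [DecidableEq V] (𝒯 : Finset (Finset V)) (i j : V) : Prop :=
  i ≠ j ∧ ∃ T ∈ 𝒯, i ∈ T ∧ j ∈ T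

instance {V : Type*} [DecidableEq V] (𝒯 : Finset (Finset V)) (i j : V) :
    Decidable (IsEdge 𝒯 i j) := by
  unfold IsEdge; infer_instance

/-- A three-dimensional conformal structure on an open set `U ⊆ ℝ^V` for a collection
`𝒯` of tetrahedra: a smooth assignment `f ↦ d f i j` of reals to ordered edges, where
`d f i j` depends only on `f i` and `f j`, the induced lengths `ℓ_ij = d_ij + d_ji` are
positive and make every member of `𝒯` a nondegenerate Euclidean tetrahedron, the metric
condition holds on every triangular face, and `∂ℓ_ij/∂f_i = d_ij`. -/
structure Conformal3D (V : Type*) [Fintype V] [DecidableEq V]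
    (𝒯 : Finset (Finset V)) (U : Set (V → ℝ)) where
  d : (V → ℝ) → V → V → ℝ
  openU : IsOpen U
  card4 : ∀ T ∈ 𝒯, T.card = 4
  smooth : ∀ i j, IsEdge 𝒯 i j → ContDiffOn ℝ (⊤ : ℕ∞) (fun f => d f i j) U
  localDep : ∀ i j, IsEdge 𝒯 i j → ∀ f g : V → ℝ, f i = g i → f j = g j →
    d f i j = d g i j
  lenPos : ∀ f ∈ U, ∀ i j, IsEdge 𝒯 i j → 0 < d f i j + d f j i
  nondeg : ∀ f ∈ U, ∀ T ∈ 𝒯, ∀ i ∈ T, ∀ j ∈ T, ∀ k ∈ T, ∀ l ∈ T,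
    i ≠ j → i ≠ k → i ≠ l → j ≠ k → j ≠ l → k ≠ l →
    0 < cmDet (d f i j + d f j i) (d f i k + d f k i) (d f i l + d f l i)
      (d f j k + d f k j) (d f j l + d f l j) (d f k l + d f l k)
  metricCond : ∀ f ∈ U, ∀ T ∈ 𝒯, ∀ i ∈ T, ∀ j ∈ T, ∀ k ∈ T, i ≠ j → i ≠ k → j ≠ k →
    d f i j ^ 2 + d f j k ^ 2 + d f k i ^ 2 = d f j i ^ 2 + d f k j ^ 2 + d f i k ^ 2
  derivLen : ∀ i j, IsEdge 𝒯 i j → ∀ f ∈ U,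
    HasDerivAt (fun s : ℝ =>
        d (Function.update f i s) i j + d (Function.update f i s) j i)
      (d f i j) (f i)

namespace Conformal3D

variable {V : Type*} [Fintype V] [DecidableEq V] {𝒯 : Finset (Finset V)}
  {U : Set (V → ℝ)}

/-- The length `ℓ_ij = d_ij + d_ji`. -/
noncomputable def len (C : Conformal3D V 𝒯 U) (f : V → ℝ) (i j : V) : ℝ :=
  C.d f i j + C.d f j i

/-- The face angle `γ_{i,jk}` at vertex `i` in the triangle `{i, j, k}`. -/
noncomputable def fang (C : Conformal3D V 𝒯 U) (f : V → ℝ) (i j k : V) : ℝ :=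
  triAngle (C.len f i j) (C.len f i k) (C.len f j k)

/-- `h_{ij,k} = (d_ik − d_ij cos γ_{i,jk}) / sin γ_{i,jk}`. -/
noncomputable def hf (C : Conformal3D V 𝒯 U) (f : V → ℝ) (i j k : V) : ℝ :=
  (C.d f i k - C.d f i j * Real.cos (C.fang f i j k)) / Real.sin (C.fang f i j k)

/-- The dihedral angle `β_{ij,kl}` at edge `{i,j}` in the tetrahedron `{i,j,k,l}`. -/
noncomputable def beta (C : Conformal3D V 𝒯 U) (f : V → ℝ) (i j k l : V) : ℝ :=
  dihedralAngle (C.len f i j) (C.len f i k) (C.len f i l)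
    (C.len f j k) (C.len f j l) (C.len f k l)

/-- `h_{ijk,l} = (h_{ij,l} − h_{ij,k} cos β_{ij,kl}) / sin β_{ij,kl}`. -/
noncomputable def ht (C : Conformal3D V 𝒯 U) (f : V → ℝ) (i j k l : V) : ℝ :=
  (C.hf f i j l - C.hf f i j k * Real.cos (C.beta f i j k l)) /
    Real.sin (C.beta f i j k l)

/-- The dual area `A_{ij,kl} = ½(h_{ij,k} h_{ijk,l} + h_{ij,l} h_{ijl,k})`. -/
noncomputable def Aq (C : Conformal3D V 𝒯 U) (f : V → ℝ) (i j k l : V) : ℝ :=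
  (1 / 2) * (C.hf f i j k * C.ht f i j k l + C.hf f i j l * C.ht f i j l k)

/-- The dual length (area) `ℓ*_ij = Σ_{{i,j,k,l} ∈ 𝒯} A_{ij,kl}` (each unordered
tetrahedron containing `{i,j}` counted once; the ordered double sum over `k, l`
counts it twice, whence `1/2`). -/
noncomputable def dualLen (C : Conformal3D V 𝒯 U) (f : V → ℝ) (i j : V) : ℝ :=
  (1 / 2) * ∑ k : V, ∑ l : V,
    if ({i, j, k, l} : Finset V) ∈ 𝒯 ∧ i ≠ j ∧ i ≠ k ∧ i ≠ l ∧ j ≠ k ∧ j ≠ l ∧ k ≠ l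
    then C.Aq f i j k l else 0

/-- The sum `Σ_{{i,j,k,l} ∈ 𝒯} β_{ij,kl}` of dihedral angles around the edge `{i,j}`. -/
noncomputable def angSum (C : Conformal3D V 𝒯 U) (f : V → ℝ) (i j : V) : ℝ :=
  (1 / 2) * ∑ k : V, ∑ l : V,
    if ({i, j, k, l} : Finset V) ∈ 𝒯 ∧ i ≠ j ∧ i ≠ k ∧ i ≠ l ∧ j ≠ k ∧ j ≠ l ∧ k ≠ l
    then C.beta f i j k l else 0

/-- The edge curvature `K_ij = (2π − Σ_{{i,j,k,l} ∈ 𝒯} β_{ij,kl}) ℓ_ij`. -/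
noncomputable def Kedge (C : Conformal3D V 𝒯 U) (f : V → ℝ) (i j : V) : ℝ :=
  (2 * Real.pi - C.angSum f i j) * C.len f i j

/-- The scalar curvature `K_i = Σ_{j : {i,j} edge} (2π − Σ β_{ij,kl}) d_ij`. -/
noncomputable def Kv (C : Conformal3D V 𝒯 U) (f : V → ℝ) (i : V) : ℝ :=
  ∑ j : V, if IsEdge 𝒯 i j then (2 * Real.pi - C.angSum f i j) * C.d f i j else 0

/-- `q_ij = ∂d_ij/∂f_j`. -/
noncomputable def qq (C : Conformal3D V 𝒯 U) (f : V → ℝ) (i j : V) : ℝ :=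
  deriv (fun s : ℝ => C.d (Function.update f j s) i j) (f j)

/-- The Einstein–Hilbert–Regge functional `EHR = Σ_{edges {i,j}} K_ij`
(ordered double sum halved). -/
noncomputable def EHR (C : Conformal3D V 𝒯 U) (f : V → ℝ) : ℝ :=
  (1 / 2) * ∑ i : V, ∑ j : V, if IsEdge 𝒯 i j then C.Kedge f i j else 0

end Conformal3D

/-- Sixteen times the squared area of a Euclidean triangle with side lengths `a`, `b`, `c`. -/
def heron (a b c : ℝ) : ℝ := (2 * a * b) ^ 2 - (a ^ 2 + b ^ 2 - c ^ 2) ^ 2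

/-- The numerator of the cosine of the dihedral angle, as a polynomial in the edge lengths. -/
def dihedralNum (a b c p q r : ℝ) : ℝ :=
  2 * a ^ 2 * (b ^ 2 + c ^ 2 - r ^ 2) - (a ^ 2 + b ^ 2 - p ^ 2) * (a ^ 2 + c ^ 2 - q ^ 2)

lemma cmDet_eq (a b c p q r : ℝ) :
    cmDet a b c p q r = 2 * (a ^ 2 * r ^ 2 * (b ^ 2 + c ^ 2 + p ^ 2 + q ^ 2 - a ^ 2 - r ^ 2) +
      b ^ 2 * q ^ 2 * (a ^ 2 + c ^ 2 + p ^ 2 + r ^ 2 - b ^ 2 - q ^ 2) +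
      c ^ 2 * p ^ 2 * (a ^ 2 + b ^ 2 + q ^ 2 + r ^ 2 - c ^ 2 - p ^ 2) -
      a ^ 2 * b ^ 2 * p ^ 2 - a ^ 2 * c ^ 2 * q ^ 2 - b ^ 2 * c ^ 2 * r ^ 2 -
      p ^ 2 * q ^ 2 * r ^ 2) := by
  simp [cmDet, Matrix.det_succ_row_zero, Fin.sum_univ_succ, Fin.succAbove]
  ring

lemma heron_mul_heron_sub (a b c p q r : ℝ) :
    heron a b p * heron a c q - dihedralNum a b c p q r ^ 2 =
      2 * a ^ 2 * cmDet a b c p q r := by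
  rw [cmDet_eq]; unfold heron dihedralNum; ring

lemma sin_triAngle {a b : ℝ} (ha : 0 < a) (hb : 0 < b) (c : ℝ) :
    Real.sin (triAngle a b c) = √(heron a b c) / (2 * a * b) := by
  have h : 1 - ((a ^ 2 + b ^ 2 - c ^ 2) / (2 * a * b)) ^ 2 =
      heron a b c / (2 * a * b) ^ 2 := by
    unfold heron; field_simp
  rw [triAngle, Real.sin_arccos, h, Real.sqrt_div' _ (by positivity),
    Real.sqrt_sq (by positivity)]

lemma cos_triAngle {a b c : ℝ} (ha : 0 < a) (hb : 0 < b) (h : 0 ≤ heron a b c) :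
    Real.cos (triAngle a b c) = (a ^ 2 + b ^ 2 - c ^ 2) / (2 * a * b) := by
  have h1 : ((a ^ 2 + b ^ 2 - c ^ 2) / (2 * a * b)) ^ 2 ≤ 1 := by
    rw [div_pow, div_le_one (by positivity)]
    unfold heron at h; linarith
  have h2 := abs_le.1 ((sq_le_one_iff_abs_le_one _).1 h1)
  rw [triAngle, Real.cos_arccos h2.1 h2.2]

/-- The dihedral angle as the arccosine of a polynomial numerator over the areas of the two
adjacent faces. Degenerate or non-Euclidean adjacent faces give `arccos 0` on both sides. -/
lemma dihedralAngle_eq {a b c p q r : ℝ} (ha : 0 < a) (hb : 0 < b) (hc : 0 < c)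
    (hr : 0 < heron a b p → 0 < heron a c q → 0 ≤ heron b c r) :
    dihedralAngle a b c p q r =
      Real.arccos (dihedralNum a b c p q r / (√(heron a b p) * √(heron a c q))) := by
  unfold dihedralAngle
  rw [sin_triAngle ha hb, sin_triAngle ha hc]
  rcases le_or_gt (heron a b p) 0 with h1 | h1
  · simp [Real.sqrt_eq_zero_of_nonpos h1]
  rcases le_or_gt (heron a c q) 0 with h2 | h2
  · simp [Real.sqrt_eq_zero_of_nonpos h2]
  rw [cos_triAngle ha hb h1.le, cos_triAngle ha hc h2.le, cos_triAngle hb hc (hr h1 h2)]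
  have s1 := Real.sqrt_pos.2 h1
  have s2 := Real.sqrt_pos.2 h2
  congr 1
  unfold dihedralNum
  field_simp

/-- Two faces of a tetrahedron with positive Cayley–Menger determinant are simultaneously
Euclidean or simultaneously Lorentzian. -/
lemma heron_mul_heron_pos {a b c p q r : ℝ} (ha : 0 < a) (hD : 0 < cmDet a b c p q r) :
    0 < heron a b p * heron a c q := by
  have := heron_mul_heron_sub a b c p q r
  have : 0 < 2 * a ^ 2 * cmDet a b c p q r := by positivity
  nlinarith [sq_nonneg (dihedralNum a b c p q r)]

lemma cmDet_swap12 (a b c p q r : ℝ) : cmDet a p q b c r = cmDet a b c p q r := by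
  simp only [cmDet_eq]; ring

lemma cmDet_swap23 (a b c p q r : ℝ) : cmDet b a c p r q = cmDet a b c p q r := by
  simp only [cmDet_eq]; ring

lemma heron_swap (a b c : ℝ) : heron b a c = heron a b c := by
  unfold heron; ring

/-- Closed form of the dihedral angle for a positive Cayley–Menger determinant. -/
lemma dihedralAngle_eq_of_cmDet_pos {a b c p q r : ℝ} (ha : 0 < a) (hb : 0 < b) (hc : 0 < c)
    (hD : 0 < cmDet a b c p q r) :
    dihedralAngle a b c p q r =
      Real.arccos (dihedralNum a b c p q r / (√(heron a b p) * √(heron a c q))) := by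
  refine dihedralAngle_eq ha hb hc fun h1 _ => ?_
  have := heron_mul_heron_pos hb (by rwa [cmDet_swap23] : 0 < cmDet b a c p r q)
  rw [heron_swap a b] at this
  exact (pos_of_mul_pos_right this h1.le).le

lemma dihedralAngle_swap {a b c p q r : ℝ} (ha : 0 < a) (hb : 0 < b) (hc : 0 < c)
    (hp : 0 < p) (hq : 0 < q) (hD : 0 < cmDet a b c p q r) :
    dihedralAngle a p q b c r = dihedralAngle a b c p q r := by
  rw [dihedralAngle_eq_of_cmDet_pos ha hb hc hD,
    dihedralAngle_eq_of_cmDet_pos ha hp hq (by rwa [cmDet_swap12])]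
  have h1 : heron a p b = heron a b p := by unfold heron; ring
  have h2 : heron a q c = heron a c q := by unfold heron; ring
  have h3 : dihedralNum a p q b c r = dihedralNum a b c p q r := by unfold dihedralNum; ring
  rw [h1, h2, h3]

/-- The derivative of `arccos (N / (√H * √K))`. -/
lemma hasDerivAt_arccos_div_sqrt {N H K : ℝ → ℝ} {N' H' K' t s : ℝ}
    (hN : HasDerivAt N N' t) (hH : HasDerivAt H H' t) (hK : HasDerivAt K K' t)
    (hHpos : 0 < H t) (hKpos : 0 < K t) (hs : 0 < s) (hNs : H t * K t - N t ^ 2 = s ^ 2) :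
    HasDerivAt (fun u => Real.arccos (N u / (√(H u) * √(K u))))
      (-(N' - N t / 2 * (H' / H t + K' / K t)) / s) t := by
  have sH := Real.sqrt_pos.2 hHpos
  have sK := Real.sqrt_pos.2 hKpos
  have eH := Real.sq_sqrt hHpos.le
  have eK := Real.sq_sqrt hKpos.le
  have hsq : 1 - (N t / (√(H t) * √(K t))) ^ 2 = (s / (√(H t) * √(K t))) ^ 2 := by
    rw [div_pow, div_pow, mul_pow, eH, eK]
    field_simp
    linarith
  have hlt : 0 < (s / (√(H t) * √(K t))) ^ 2 := by positivity
  have hm1 : N t / (√(H t) * √(K t)) ≠ -1 := by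
    intro h; rw [h] at hsq; norm_num at hsq; linarith
  have hp1 : N t / (√(H t) * √(K t)) ≠ 1 := by
    intro h; rw [h] at hsq; norm_num at hsq; linarith
  have hq := hN.fun_div ((hH.sqrt hHpos.ne').fun_mul (hK.sqrt hKpos.ne')) (mul_pos sH sK).ne'
  have := (Real.hasDerivAt_arccos hm1 hp1).comp t hq
  rw [hsq, Real.sqrt_sq (by positivity)] at this
  refine this.congr_deriv ?_
  rw [← eH, ← eK]
  simp only [Real.sqrt_sq sH.le, Real.sqrt_sq sK.le]
  field_simp

section Schlaefli

variable {a b c p q r : ℝ → ℝ} {t : ℝ}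

lemma continuousAt_cmDet (ha : ContinuousAt a t) (hb : ContinuousAt b t)
    (hc : ContinuousAt c t) (hp : ContinuousAt p t) (hq : ContinuousAt q t)
    (hr : ContinuousAt r t) :
    ContinuousAt (fun u => cmDet (a u) (b u) (c u) (p u) (q u) (r u)) t := by
  simp only [cmDet_eq]
  fun_prop

lemma differentiableAt_heron (ha : DifferentiableAt ℝ a t) (hb : DifferentiableAt ℝ b t)
    (hc : DifferentiableAt ℝ c t) :
    DifferentiableAt ℝ (fun u => heron (a u) (b u) (c u)) t := by
  unfold heron; fun_prop

lemma differentiableAt_dihedralNum (ha : DifferentiableAt ℝ a t) (hb : DifferentiableAt ℝ b t)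
    (hc : DifferentiableAt ℝ c t) (hp : DifferentiableAt ℝ p t) (hq : DifferentiableAt ℝ q t)
    (hr : DifferentiableAt ℝ r t) :
    DifferentiableAt ℝ (fun u => dihedralNum (a u) (b u) (c u) (p u) (q u) (r u)) t := by
  unfold dihedralNum; fun_prop

/-- Near a tetrahedron with positive Cayley–Menger determinant the dihedral angle has its
closed form. -/
lemma dihedralAngle_eventuallyEq (ha : ContinuousAt a t) (hb : ContinuousAt b t)
    (hc : ContinuousAt c t) (hp : ContinuousAt p t) (hq : ContinuousAt q t)
    (hr : ContinuousAt r t) (ha0 : 0 < a t) (hb0 : 0 < b t) (hc0 : 0 < c t)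
    (hD : 0 < cmDet (a t) (b t) (c t) (p t) (q t) (r t)) :
    (fun u => dihedralAngle (a u) (b u) (c u) (p u) (q u) (r u)) =ᶠ[nhds t]
      fun u => Real.arccos (dihedralNum (a u) (b u) (c u) (p u) (q u) (r u) /
        (√(heron (a u) (b u) (p u)) * √(heron (a u) (c u) (q u)))) := by
  filter_upwards [ha.eventually_const_lt ha0, hb.eventually_const_lt hb0,
    hc.eventually_const_lt hc0, (continuousAt_cmDet ha hb hc hp hq hr).eventually_const_lt hD]
    with u h1 h2 h3 h4
  exact dihedralAngle_eq_of_cmDet_pos h1 h2 h3 h4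

lemma hasDerivAt_dihedralAngle_of_pos (ha : DifferentiableAt ℝ a t)
    (hb : DifferentiableAt ℝ b t) (hc : DifferentiableAt ℝ c t) (hp : DifferentiableAt ℝ p t)
    (hq : DifferentiableAt ℝ q t) (hr : DifferentiableAt ℝ r t)
    (ha0 : 0 < a t) (hb0 : 0 < b t) (hc0 : 0 < c t)
    (hD : 0 < cmDet (a t) (b t) (c t) (p t) (q t) (r t))
    (hH : 0 < heron (a t) (b t) (p t)) :
    HasDerivAt (fun u => dihedralAngle (a u) (b u) (c u) (p u) (q u) (r u))
      (-(deriv (fun u => dihedralNum (a u) (b u) (c u) (p u) (q u) (r u)) t -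
          dihedralNum (a t) (b t) (c t) (p t) (q t) (r t) / 2 *
            (deriv (fun u => heron (a u) (b u) (p u)) t / heron (a t) (b t) (p t) +
              deriv (fun u => heron (a u) (c u) (q u)) t / heron (a t) (c t) (q t))) /
        (a t * √(2 * cmDet (a t) (b t) (c t) (p t) (q t) (r t)))) t := by
  have hK := pos_of_mul_pos_right (heron_mul_heron_pos ha0 hD) hH.le
  refine HasDerivAt.congr_of_eventuallyEq ?_ (dihedralAngle_eventuallyEq ha.continuousAt
    hb.continuousAt hc.continuousAt hp.continuousAt hq.continuousAt hr.continuousAt ha0 hb0 hc0 hD)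
  refine hasDerivAt_arccos_div_sqrt (differentiableAt_dihedralNum ha hb hc hp hq hr).hasDerivAt
    (differentiableAt_heron ha hb hp).hasDerivAt (differentiableAt_heron ha hc hq).hasDerivAt
    hH hK (by positivity) ?_
  rw [heron_mul_heron_sub, mul_pow, Real.sq_sqrt (by positivity)]
  ring

lemma hasDerivAt_dihedralAngle_of_neg (ha : DifferentiableAt ℝ a t)
    (hb : DifferentiableAt ℝ b t) (hc : DifferentiableAt ℝ c t) (hp : DifferentiableAt ℝ p t)
    (hq : DifferentiableAt ℝ q t) (hr : DifferentiableAt ℝ r t)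
    (ha0 : 0 < a t) (hb0 : 0 < b t) (hc0 : 0 < c t)
    (hD : 0 < cmDet (a t) (b t) (c t) (p t) (q t) (r t))
    (hH : heron (a t) (b t) (p t) < 0) :
    HasDerivAt (fun u => dihedralAngle (a u) (b u) (c u) (p u) (q u) (r u)) 0 t := by
  refine HasDerivAt.congr_of_eventuallyEq (hasDerivAt_const t (Real.arccos 0)) ?_
  filter_upwards [dihedralAngle_eventuallyEq ha.continuousAt hb.continuousAt hc.continuousAt
    hp.continuousAt hq.continuousAt hr.continuousAt ha0 hb0 hc0 hD,
    (differentiableAt_heron ha hb hp).continuousAt.eventually_lt_const hH] with u h1 h2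
  rw [h1, Real.sqrt_eq_zero_of_nonpos h2.le, zero_mul, div_zero]

lemma differentiableAt_dihedralAngle (ha : DifferentiableAt ℝ a t)
    (hb : DifferentiableAt ℝ b t) (hc : DifferentiableAt ℝ c t) (hp : DifferentiableAt ℝ p t)
    (hq : DifferentiableAt ℝ q t) (hr : DifferentiableAt ℝ r t)
    (ha0 : 0 < a t) (hb0 : 0 < b t) (hc0 : 0 < c t)
    (hD : 0 < cmDet (a t) (b t) (c t) (p t) (q t) (r t)) :
    DifferentiableAt ℝ (fun u => dihedralAngle (a u) (b u) (c u) (p u) (q u) (r u)) t := by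
  rcases lt_or_gt_of_ne (left_ne_zero_of_mul (heron_mul_heron_pos ha0 hD).ne') with h | h
  · exact (hasDerivAt_dihedralAngle_of_neg ha hb hc hp hq hr ha0 hb0 hc0 hD h).differentiableAt
  · exact (hasDerivAt_dihedralAngle_of_pos ha hb hc hp hq hr ha0 hb0 hc0 hD h).differentiableAt

lemma deriv_eq_add_add {H f g h : ℝ → ℝ} {t : ℝ} (hf : DifferentiableAt ℝ f t)
    (hg : DifferentiableAt ℝ g t) (hh : DifferentiableAt ℝ h t)
    (hH : ∀ u, H u = f u + g u + h u) : deriv H t = deriv f t + deriv g t + deriv h t := by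
  rw [← deriv_fun_add hf hg, ← deriv_fun_add (hf.fun_add hg) hh, funext hH]

/-- The Schläfli formula: `∑ ℓ dβ = 0` over the six edges of a tetrahedron. -/
lemma schlaefli (ha : DifferentiableAt ℝ a t)
    (hb : DifferentiableAt ℝ b t) (hc : DifferentiableAt ℝ c t) (hp : DifferentiableAt ℝ p t)
    (hq : DifferentiableAt ℝ q t) (hr : DifferentiableAt ℝ r t)
    (ha0 : 0 < a t) (hb0 : 0 < b t) (hc0 : 0 < c t) (hp0 : 0 < p t) (hq0 : 0 < q t)
    (hr0 : 0 < r t) (hD : 0 < cmDet (a t) (b t) (c t) (p t) (q t) (r t)) :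
    a t * deriv (fun u => dihedralAngle (a u) (b u) (c u) (p u) (q u) (r u)) t +
    b t * deriv (fun u => dihedralAngle (b u) (a u) (c u) (p u) (r u) (q u)) t +
    c t * deriv (fun u => dihedralAngle (c u) (a u) (b u) (q u) (r u) (p u)) t +
    p t * deriv (fun u => dihedralAngle (p u) (a u) (q u) (b u) (r u) (c u)) t +
    q t * deriv (fun u => dihedralAngle (q u) (a u) (p u) (c u) (r u) (b u)) t +
    r t * deriv (fun u => dihedralAngle (r u) (b u) (p u) (c u) (q u) (a u)) t = 0 := by
  have eb : cmDet (b t) (a t) (c t) (p t) (r t) (q t) =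
      cmDet (a t) (b t) (c t) (p t) (q t) (r t) := by simp only [cmDet_eq]; ring
  have ec : cmDet (c t) (a t) (b t) (q t) (r t) (p t) =
      cmDet (a t) (b t) (c t) (p t) (q t) (r t) := by simp only [cmDet_eq]; ring
  have ep : cmDet (p t) (a t) (q t) (b t) (r t) (c t) =
      cmDet (a t) (b t) (c t) (p t) (q t) (r t) := by simp only [cmDet_eq]; ring
  have eq : cmDet (q t) (a t) (p t) (c t) (r t) (b t) =
      cmDet (a t) (b t) (c t) (p t) (q t) (r t) := by simp only [cmDet_eq]; ring
  have er : cmDet (r t) (b t) (p t) (c t) (q t) (a t) =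
      cmDet (a t) (b t) (c t) (p t) (q t) (r t) := by simp only [cmDet_eq]; ring
  have h12 := heron_mul_heron_pos ha0 hD
  have h13 := heron_mul_heron_pos hb0 (eb ▸ hD)
  have h14 := heron_mul_heron_pos hp0 (ep ▸ hD)
  have hba : ∀ u, heron (b u) (a u) (p u) = heron (a u) (b u) (p u) := fun u => by
    unfold heron; ring
  have hca : ∀ u, heron (c u) (a u) (q u) = heron (a u) (c u) (q u) := fun u => by
    unfold heron; ring
  have hcb : ∀ u, heron (c u) (b u) (r u) = heron (b u) (c u) (r u) := fun u => by
    unfold heron; ring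
  have hpa : ∀ u, heron (p u) (a u) (b u) = heron (a u) (b u) (p u) := fun u => by
    unfold heron; ring
  have hqa : ∀ u, heron (q u) (a u) (c u) = heron (a u) (c u) (q u) := fun u => by
    unfold heron; ring
  have hqp : ∀ u, heron (q u) (p u) (r u) = heron (p u) (q u) (r u) := fun u => by
    unfold heron; ring
  have hrb : ∀ u, heron (r u) (b u) (c u) = heron (b u) (c u) (r u) := fun u => by
    unfold heron; ring
  have hrp : ∀ u, heron (r u) (p u) (q u) = heron (p u) (q u) (r u) := fun u => by
    unfold heron; ring
  rw [hba] at h13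
  rw [hpa] at h14
  rcases lt_or_gt_of_ne (left_ne_zero_of_mul h12.ne') with h1 | h1
  · have h2 := neg_of_mul_pos_right h12 h1.le
    have h3 := neg_of_mul_pos_right h13 h1.le
    rw [(hasDerivAt_dihedralAngle_of_neg ha hb hc hp hq hr ha0 hb0 hc0 hD h1).deriv,
      (hasDerivAt_dihedralAngle_of_neg hb ha hc hp hr hq hb0 ha0 hc0 (eb ▸ hD)
        (by rwa [hba])).deriv,
      (hasDerivAt_dihedralAngle_of_neg hc ha hb hq hr hp hc0 ha0 hb0 (ec ▸ hD)
        (by rwa [hca])).deriv,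
      (hasDerivAt_dihedralAngle_of_neg hp ha hq hb hr hc hp0 ha0 hq0 (ep ▸ hD)
        (by rwa [hpa])).deriv,
      (hasDerivAt_dihedralAngle_of_neg hq ha hp hc hr hb hq0 ha0 hp0 (eq ▸ hD)
        (by rwa [hqa])).deriv,
      (hasDerivAt_dihedralAngle_of_neg hr hb hp hc hq ha hr0 hb0 hp0 (er ▸ hD)
        (by rwa [hrb])).deriv]
    simp
  · have h2 := pos_of_mul_pos_right h12 h1.le
    have h3 := pos_of_mul_pos_right h13 h1.le
    have h4 := pos_of_mul_pos_right h14 h1.le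
    rw [(hasDerivAt_dihedralAngle_of_pos ha hb hc hp hq hr ha0 hb0 hc0 hD h1).deriv,
      (hasDerivAt_dihedralAngle_of_pos hb ha hc hp hr hq hb0 ha0 hc0 (eb ▸ hD)
        (by rwa [hba])).deriv,
      (hasDerivAt_dihedralAngle_of_pos hc ha hb hq hr hp hc0 ha0 hb0 (ec ▸ hD)
        (by rwa [hca])).deriv,
      (hasDerivAt_dihedralAngle_of_pos hp ha hq hb hr hc hp0 ha0 hq0 (ep ▸ hD)
        (by rwa [hpa])).deriv,
      (hasDerivAt_dihedralAngle_of_pos hq ha hp hc hr hb hq0 ha0 hp0 (eq ▸ hD)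
        (by rwa [hqa])).deriv,
      (hasDerivAt_dihedralAngle_of_pos hr hb hp hc hq ha hr0 hb0 hp0 (er ▸ hD)
        (by rwa [hrb])).deriv]
    rw [eb, ec, ep, eq, er]
    simp only [hba, hca, hcb, hpa, hqa, hqp, hrb, hrp]
    have f1 : ∀ u, heron (a u) (b u) (p u) = dihedralNum (a u) (b u) (c u) (p u) (q u) (r u) +
        dihedralNum (b u) (a u) (c u) (p u) (r u) (q u) +
        dihedralNum (p u) (a u) (q u) (b u) (r u) (c u) := fun u => by
      unfold heron dihedralNum; ring
    have d1 := deriv_eq_add_add (differentiableAt_dihedralNum ha hb hc hp hq hr)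
      (differentiableAt_dihedralNum hb ha hc hp hr hq)
      (differentiableAt_dihedralNum hp ha hq hb hr hc) f1
    have f2 : ∀ u, heron (a u) (c u) (q u) = dihedralNum (a u) (b u) (c u) (p u) (q u) (r u) +
        dihedralNum (c u) (a u) (b u) (q u) (r u) (p u) +
        dihedralNum (q u) (a u) (p u) (c u) (r u) (b u) := fun u => by
      unfold heron dihedralNum; ring
    have d2 := deriv_eq_add_add (differentiableAt_dihedralNum ha hb hc hp hq hr)
      (differentiableAt_dihedralNum hc ha hb hq hr hp)
      (differentiableAt_dihedralNum hq ha hp hc hr hb) f2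
    have f3 : ∀ u, heron (b u) (c u) (r u) = dihedralNum (b u) (a u) (c u) (p u) (r u) (q u) +
        dihedralNum (c u) (a u) (b u) (q u) (r u) (p u) +
        dihedralNum (r u) (b u) (p u) (c u) (q u) (a u) := fun u => by
      unfold heron dihedralNum; ring
    have d3 := deriv_eq_add_add (differentiableAt_dihedralNum hb ha hc hp hr hq)
      (differentiableAt_dihedralNum hc ha hb hq hr hp)
      (differentiableAt_dihedralNum hr hb hp hc hq ha) f3
    have f4 : ∀ u, heron (p u) (q u) (r u) = dihedralNum (p u) (a u) (q u) (b u) (r u) (c u) +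
        dihedralNum (q u) (a u) (p u) (c u) (r u) (b u) +
        dihedralNum (r u) (b u) (p u) (c u) (q u) (a u) := fun u => by
      unfold heron dihedralNum; ring
    have d4 := deriv_eq_add_add (differentiableAt_dihedralNum hp ha hq hb hr hc)
      (differentiableAt_dihedralNum hq ha hp hc hr hb)
      (differentiableAt_dihedralNum hr hb hp hc hq ha) f4
    have hS : √(2 * cmDet (a t) (b t) (c t) (p t) (q t) (r t)) ≠ 0 := by positivity
    generalize √(2 * cmDet (a t) (b t) (c t) (p t) (q t) (r t)) = S at hS ⊢
    have cancel : ∀ x y : ℝ, 0 < x → x * (y / (x * S)) = y / S := fun x y hx => by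
      field_simp
    rw [cancel _ _ ha0, cancel _ _ hb0, cancel _ _ hc0, cancel _ _ hp0, cancel _ _ hq0,
      cancel _ _ hr0]
    simp only [← add_div]
    rw [div_eq_zero_iff]
    left
    have g1 := div_mul_cancel₀ (deriv (fun u => heron (a u) (b u) (p u)) t) h1.ne'
    have g2 := div_mul_cancel₀ (deriv (fun u => heron (a u) (c u) (q u)) t) h2.ne'
    have g3 := div_mul_cancel₀ (deriv (fun u => heron (b u) (c u) (r u)) t) h3.ne'
    have g4 := div_mul_cancel₀ (deriv (fun u => heron (p u) (q u) (r u)) t) h4.ne'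
    have e1 := f1 t
    have e2 := f2 t
    have e3 := f3 t
    have e4 := f4 t
    generalize deriv (fun u => heron (a u) (b u) (p u)) t / heron (a t) (b t) (p t) = u1 at *
    generalize deriv (fun u => heron (a u) (c u) (q u)) t / heron (a t) (c t) (q t) = u2 at *
    generalize deriv (fun u => heron (b u) (c u) (r u)) t / heron (b t) (c t) (r t) = u3 at *
    generalize deriv (fun u => heron (p u) (q u) (r u)) t / heron (p t) (q t) (r t) = u4 at *
    linear_combination (1 / 2) * (g1 + g2 + g3 + g4 + d1 + d2 + d3 + d4
      - u1 * e1 - u2 * e2 - u3 * e3 - u4 * e4)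

end Schlaefli

lemma sum_quadruple_permute {V : Type*} [Fintype V] (X : V → V → V → V → ℝ) :
    ∑ i, ∑ j, ∑ k, ∑ l, (X i j k l + X i k j l + X i l j k + X j k i l + X j l i k + X k l i j) =
      6 * ∑ i, ∑ j, ∑ k, ∑ l, X i j k l := by
  have s12 (Y : V → V → V → V → ℝ) :
      ∑ i, ∑ j, ∑ k, ∑ l, Y j i k l = ∑ i, ∑ j, ∑ k, ∑ l, Y i j k l := Finset.sum_comm
  have s23 (Y : V → V → V → V → ℝ) :
      ∑ i, ∑ j, ∑ k, ∑ l, Y i k j l = ∑ i, ∑ j, ∑ k, ∑ l, Y i j k l :=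
    Finset.sum_congr rfl fun _ _ => Finset.sum_comm
  have s34 (Y : V → V → V → V → ℝ) :
      ∑ i, ∑ j, ∑ k, ∑ l, Y i j l k = ∑ i, ∑ j, ∑ k, ∑ l, Y i j k l :=
    Finset.sum_congr rfl fun _ _ => Finset.sum_congr rfl fun _ _ => Finset.sum_comm
  have h2 := s34 fun i j k l => X i k j l
  have h3 := s12 fun i j k l => X i k j l
  have h4 := s12 fun i j k l => X i l j k
  have h5 := s23 fun i j k l => X j l i k
  simp only [Finset.sum_add_distrib]
  rw [h5, h4, h3, h2, s23]
  ring

lemma fderiv_apply_eq_of_two_coords {V : Type*} [Fintype V] [DecidableEq V]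
    {g : (V → ℝ) → ℝ} {x : V → ℝ} {i j : V} {α β : ℝ} (hij : i ≠ j)
    (hg : DifferentiableAt ℝ g x) (hloc : ∀ y z : V → ℝ, y i = z i → y j = z j → g y = g z)
    (hi : HasDerivAt (fun s => g (Function.update x i s)) α (x i))
    (hj : HasDerivAt (fun s => g (Function.update x j s)) β (x j)) (v : V → ℝ) :
    fderiv ℝ g x v = α * v i + β * v j := by
  have key (m : V) (γ : ℝ) (hm : HasDerivAt (fun s => g (Function.update x m s)) γ (x m)) :
      fderiv ℝ g x (Pi.single m 1) = γ := by
    have h1 : HasFDerivAt g (fderiv ℝ g x) (Function.update x m (x m)) := by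
      rw [Function.update_eq_self]; exact hg.hasFDerivAt
    exact (h1.comp_hasDerivAt (x m) (hasDerivAt_update x m (x m))).unique hm
  have hrest : fderiv ℝ g x (v - v i • Pi.single i 1 - v j • Pi.single j 1) = 0 := by
    set w := v - v i • Pi.single i (1 : ℝ) - v j • Pi.single j (1 : ℝ) with hw
    have hwi : w i = 0 := by simp [hw, hij]
    have hwj : w j = 0 := by simp [hw, hij.symm]
    have h1 : HasFDerivAt g (fderiv ℝ g x) (x + (0 : ℝ) • w) := by
      simpa using hg.hasFDerivAt
    have h2 : HasDerivAt (fun s : ℝ => x + s • w) w 0 := by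
      simpa using ((hasDerivAt_id (0 : ℝ)).smul_const w).const_add x
    have h3 := h1.comp_hasDerivAt (0 : ℝ) h2
    refine h3.unique ((hasDerivAt_const (0 : ℝ) (g x)).congr_of_eventuallyEq ?_)
    exact Filter.Eventually.of_forall fun s => hloc _ _ (by simp [hwi]) (by simp [hwj])
  rw [map_sub, map_sub, map_smul, map_smul, key i α hi, key j β hj] at hrest
  simp only [smul_eq_mul] at hrest
  linarith

lemma IsEdge.symm {V : Type*} [DecidableEq V] {𝒯 : Finset (Finset V)} {i j : V}
    (h : IsEdge 𝒯 i j) : IsEdge 𝒯 j i :=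
  ⟨h.1.symm, h.2.imp fun _ hT => ⟨hT.1, hT.2.2, hT.2.1⟩⟩

namespace Conformal3D

variable {V : Type*} [DecidableEq V] {𝒯 : Finset (Finset V)}

/-- `i`, `j`, `k`, `l` are the distinct vertices of a tetrahedron in `𝒯`. -/
abbrev IsTet (𝒯 : Finset (Finset V)) (i j k l : V) : Prop :=
  ({i, j, k, l} : Finset V) ∈ 𝒯 ∧ i ≠ j ∧ i ≠ k ∧ i ≠ l ∧ j ≠ k ∧ j ≠ l ∧ k ≠ l

lemma IsTet.swap12 {i j k l : V} (h : IsTet 𝒯 i j k l) : IsTet 𝒯 j i k l := by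
  obtain ⟨hT, h1, h2, h3, h4, h5, h6⟩ := h
  exact ⟨by rwa [Finset.insert_comm], h1.symm, h4, h5, h2, h3, h6⟩

lemma IsTet.swap23 {i j k l : V} (h : IsTet 𝒯 i j k l) : IsTet 𝒯 i k j l := by
  obtain ⟨hT, h1, h2, h3, h4, h5, h6⟩ := h
  exact ⟨by rwa [Finset.insert_comm k], h2, h1, h3, h4.symm, h6, h5⟩

lemma IsTet.swap34 {i j k l : V} (h : IsTet 𝒯 i j k l) : IsTet 𝒯 i j l k := by
  obtain ⟨hT, h1, h2, h3, h4, h5, h6⟩ := h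
  exact ⟨by rwa [Finset.pair_comm], h1, h3, h2, h5, h4, h6.symm⟩

lemma IsTet.isEdge {i j k l : V} (h : IsTet 𝒯 i j k l) : IsEdge 𝒯 i j :=
  ⟨h.2.1, _, h.1, by simp, by simp⟩

variable [Fintype V] {U : Set (V → ℝ)} (C : Conformal3D V 𝒯 U)

lemma len_comm (x : V → ℝ) (i j : V) : C.len x i j = C.len x j i := add_comm _ _

variable {C} {x : V → ℝ} {i j k l : V}

lemma len_pos (hx : x ∈ U) (h : IsEdge 𝒯 i j) : 0 < C.len x i j := C.lenPos x hx i j h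

lemma cmDet_len_pos (hx : x ∈ U) (h : IsTet 𝒯 i j k l) :
    0 < cmDet (C.len x i j) (C.len x i k) (C.len x i l) (C.len x j k) (C.len x j l)
      (C.len x k l) :=
  C.nondeg x hx _ h.1 i (by simp) j (by simp) k (by simp) l (by simp) h.2.1 h.2.2.1 h.2.2.2.1
    h.2.2.2.2.1 h.2.2.2.2.2.1 h.2.2.2.2.2.2

lemma beta_comm (hx : x ∈ U) (h : IsTet 𝒯 i j k l) : C.beta x j i k l = C.beta x i j k l := by
  unfold beta
  rw [C.len_comm x j i]
  exact dihedralAngle_swap (len_pos hx h.isEdge) (len_pos hx h.swap23.isEdge)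
    (len_pos hx h.swap34.swap23.isEdge) (len_pos hx h.swap12.swap23.isEdge)
    (len_pos hx h.swap12.swap34.swap23.isEdge) (cmDet_len_pos hx h)

lemma angSum_comm (hx : x ∈ U) (i j : V) : C.angSum x j i = C.angSum x i j := by
  unfold angSum
  congr 1
  refine Finset.sum_congr rfl fun k _ => Finset.sum_congr rfl fun l _ => ?_
  by_cases h : IsTet 𝒯 i j k l
  · rw [if_pos h, if_pos h.swap12, beta_comm hx h]
  · rw [if_neg h, if_neg fun h' : IsTet 𝒯 j i k l => h h'.swap12]

lemma differentiableAt_len (hx : x ∈ U) (h : IsEdge 𝒯 i j) :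
    DifferentiableAt ℝ (fun y => C.len y i j) x := by
  have hd {i j : V} (h : IsEdge 𝒯 i j) : DifferentiableAt ℝ (fun y => C.d y i j) x :=
    ((C.smooth i j h).contDiffAt (C.openU.mem_nhds hx)).differentiableAt (by simp)
  exact (hd h).fun_add (hd h.symm)

section Variation

variable {f : ℝ → V → ℝ} {t : ℝ}

/-- The derivative of an edge length along a conformal variation. -/
lemma hasDerivAt_len (hf : DifferentiableAt ℝ f t) (hx : f t ∈ U) (h : IsEdge 𝒯 i j) :
    HasDerivAt (fun s => C.len (f s) i j)
      (C.d (f t) i j * deriv (fun s => f s i) t + C.d (f t) j i * deriv (fun s => f s j) t) t := by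
  have hl := differentiableAt_len hx h (C := C)
  have hpi (m : V) : deriv (fun s => f s m) t = deriv f t m :=
    ((hasDerivAt_pi.1 hf.hasDerivAt) m).deriv
  rw [hpi, hpi, ← fderiv_apply_eq_of_two_coords h.1 hl
    (fun y z hi hj => congrArg₂ (· + ·) (C.localDep i j h y z hi hj)
      (C.localDep j i h.symm y z hj hi)) (C.derivLen i j h (f t) hx)
    (by simpa only [len, add_comm] using C.derivLen j i h.symm (f t) hx)]
  exact hl.hasFDerivAt.comp_hasDerivAt t hf.hasDerivAt

lemma differentiableAt_len_comp (hf : DifferentiableAt ℝ f t) (hx : f t ∈ U)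
    (h : IsEdge 𝒯 i j) : DifferentiableAt ℝ (fun s => C.len (f s) i j) t :=
  (hasDerivAt_len hf hx h).differentiableAt

lemma differentiableAt_beta (hf : DifferentiableAt ℝ f t) (hx : f t ∈ U)
    (h : IsTet 𝒯 i j k l) : DifferentiableAt ℝ (fun s => C.beta (f s) i j k l) t :=
  differentiableAt_dihedralAngle (differentiableAt_len_comp hf hx h.isEdge)
    (differentiableAt_len_comp hf hx h.swap23.isEdge)
    (differentiableAt_len_comp hf hx h.swap34.swap23.isEdge)
    (differentiableAt_len_comp hf hx h.swap12.swap23.isEdge)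
    (differentiableAt_len_comp hf hx h.swap12.swap34.swap23.isEdge)
    (differentiableAt_len_comp hf hx h.swap23.swap12.swap34.swap23.isEdge)
    (len_pos hx h.isEdge) (len_pos hx h.swap23.isEdge) (len_pos hx h.swap34.swap23.isEdge)
    (cmDet_len_pos hx h)

/-- The Schläfli formula in one tetrahedron of a conformal structure. -/
lemma schlaefli_beta (hf : DifferentiableAt ℝ f t) (hx : f t ∈ U) (h : IsTet 𝒯 i j k l) :
    C.len (f t) i j * deriv (fun s => C.beta (f s) i j k l) t +
    C.len (f t) i k * deriv (fun s => C.beta (f s) i k j l) t +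
    C.len (f t) i l * deriv (fun s => C.beta (f s) i l j k) t +
    C.len (f t) j k * deriv (fun s => C.beta (f s) j k i l) t +
    C.len (f t) j l * deriv (fun s => C.beta (f s) j l i k) t +
    C.len (f t) k l * deriv (fun s => C.beta (f s) k l i j) t = 0 := by
  have e1 := h.isEdge
  have e2 := h.swap23.isEdge
  have e3 := h.swap34.swap23.isEdge
  have e4 := h.swap12.swap23.isEdge
  have e5 := h.swap12.swap34.swap23.isEdge
  have e6 := h.swap23.swap12.swap34.swap23.isEdge
  have := schlaefli (differentiableAt_len_comp (C := C) hf hx e1)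
    (differentiableAt_len_comp hf hx e2) (differentiableAt_len_comp hf hx e3)
    (differentiableAt_len_comp hf hx e4) (differentiableAt_len_comp hf hx e5)
    (differentiableAt_len_comp hf hx e6) (len_pos hx e1) (len_pos hx e2) (len_pos hx e3)
    (len_pos hx e4) (len_pos hx e5) (len_pos hx e6) (cmDet_len_pos hx h)
  unfold beta
  simp only [C.len_comm _ j i, C.len_comm _ k i, C.len_comm _ l i, C.len_comm _ k j,
    C.len_comm _ l j, C.len_comm _ l k]
  exact this

/-- The derivative of the sum of the dihedral angles around an edge. -/
lemma hasDerivAt_angSum (hf : DifferentiableAt ℝ f t) (hx : f t ∈ U) (i j : V) :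
    HasDerivAt (fun s => C.angSum (f s) i j)
      ((1 / 2) * ∑ k, ∑ l, if IsTet 𝒯 i j k l
        then deriv (fun s => C.beta (f s) i j k l) t else 0) t := by
  unfold angSum
  refine (HasDerivAt.fun_sum fun k _ => HasDerivAt.fun_sum fun l _ => ?_).const_mul _
  by_cases h : IsTet 𝒯 i j k l
  · simp only [if_pos h]
    exact (differentiableAt_beta hf hx h).hasDerivAt
  · simp only [if_neg h]
    exact hasDerivAt_const _ _

/-- Varying only the angles does not change the functional. -/
lemma sum_len_mul_deriv_angSum (hf : DifferentiableAt ℝ f t) (hx : f t ∈ U) :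
    ∑ i, ∑ j, (if IsEdge 𝒯 i j then
      C.len (f t) i j * deriv (fun s => C.angSum (f s) i j) t else 0) = 0 := by
  set X : V → V → V → V → ℝ := fun i j k l => if IsTet 𝒯 i j k l then
    C.len (f t) i j * deriv (fun s => C.beta (f s) i j k l) t else 0 with hX
  have hsum : ∑ i, ∑ j, ∑ k, ∑ l, X i j k l = 0 := by
    have h0 := sum_quadruple_permute X
    rw [Finset.sum_eq_zero fun i _ => Finset.sum_eq_zero fun j _ => Finset.sum_eq_zero fun k _ =>
      Finset.sum_eq_zero fun l _ => ?_] at h0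
    · linarith
    by_cases h : IsTet 𝒯 i j k l
    · simp only [hX, if_pos h, if_pos h.swap23, if_pos h.swap34.swap23,
        if_pos h.swap12.swap23, if_pos h.swap12.swap34.swap23,
        if_pos h.swap23.swap12.swap34.swap23]
      exact schlaefli_beta hf hx h
    · simp only [hX, if_neg h, if_neg fun h' : IsTet 𝒯 i k j l => h h'.swap23,
        if_neg fun h' : IsTet 𝒯 i l j k => h h'.swap23.swap34,
        if_neg fun h' : IsTet 𝒯 j k i l => h h'.swap23.swap12,
        if_neg fun h' : IsTet 𝒯 j l i k => h h'.swap23.swap34.swap12,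
        if_neg fun h' : IsTet 𝒯 k l i j => h h'.swap23.swap34.swap12.swap23, add_zero]
  have hedge (i j : V) : (if IsEdge 𝒯 i j then
      C.len (f t) i j * deriv (fun s => C.angSum (f s) i j) t else 0) =
      (1 / 2) * ∑ k, ∑ l, X i j k l := by
    rw [(hasDerivAt_angSum hf hx i j).deriv]
    by_cases h : IsEdge 𝒯 i j
    · rw [if_pos h, mul_left_comm, Finset.mul_sum]
      simp only [Finset.mul_sum, hX, mul_ite, mul_zero]
    · have h' (k l : V) : ¬ IsTet 𝒯 i j k l := fun h' => h h'.isEdge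
      simp [hX, h, h']
  simp only [hedge, ← Finset.mul_sum, hsum, mul_zero]

end Variation

end Conformal3D

open Conformal3D in
/-- Under a conformal variation `f(t)` of a three-dimensional conformal
structure, at `t = 0`: `(d/dt) EHR = Σ_{i ∈ V} K_i f_i′`. -/
theorem EHR_first_variation {V : Type*} [Fintype V] [DecidableEq V]
    {𝒯 : Finset (Finset V)} {U : Set (V → ℝ)} (C : Conformal3D V 𝒯 U)
    (ε : ℝ) (hε : 0 < ε) (f : ℝ → (V → ℝ))
    (hmem : ∀ t ∈ Set.Ioo (-ε) ε, f t ∈ U)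
    (hsmooth : ContDiffOn ℝ (⊤ : ℕ∞) f (Set.Ioo (-ε) ε)) :
    HasDerivAt (fun t => C.EHR (f t))
      (∑ i : V, C.Kv (f 0) i * deriv (fun t => f t i) 0) 0 := by
  have hx := hmem 0 ⟨by linarith, hε⟩
  have hf : DifferentiableAt ℝ f 0 :=
    (hsmooth.contDiffAt (Ioo_mem_nhds (by linarith) hε)).differentiableAt (by simp)
  have hE : HasDerivAt (fun t => C.EHR (f t)) ((1 / 2) * ∑ i, ∑ j, if IsEdge 𝒯 i j then
      (2 * Real.pi - C.angSum (f 0) i j) * (C.d (f 0) i j * deriv (fun t => f t i) 0 +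
        C.d (f 0) j i * deriv (fun t => f t j) 0) -
      C.len (f 0) i j * deriv (fun s => C.angSum (f s) i j) 0 else 0) 0 := by
    unfold EHR
    refine (HasDerivAt.fun_sum fun i _ => HasDerivAt.fun_sum fun j _ => ?_).const_mul _
    by_cases h : IsEdge 𝒯 i j
    · simp only [if_pos h]
      refine (((hasDerivAt_angSum hf hx i j).differentiableAt.hasDerivAt.const_sub _).fun_mul
        (hasDerivAt_len hf hx h)).congr_deriv ?_
      ring
    · simp only [if_neg h]
      exact hasDerivAt_const _ _
  refine hE.congr_deriv ?_
  set A : V → V → ℝ := fun i j => if IsEdge 𝒯 i j then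
    (2 * Real.pi - C.angSum (f 0) i j) * C.d (f 0) i j * deriv (fun t => f t i) 0 else 0 with hA
  have hsplit (i j : V) : (if IsEdge 𝒯 i j then
      (2 * Real.pi - C.angSum (f 0) i j) * (C.d (f 0) i j * deriv (fun t => f t i) 0 +
        C.d (f 0) j i * deriv (fun t => f t j) 0) -
      C.len (f 0) i j * deriv (fun s => C.angSum (f s) i j) 0 else 0) = A i j + A j i -
      if IsEdge 𝒯 i j then C.len (f 0) i j * deriv (fun s => C.angSum (f s) i j) 0 else 0 := by
    by_cases h : IsEdge 𝒯 i j
    · simp only [hA, if_pos h, if_pos h.symm, angSum_comm hx i j]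
      ring
    · simp only [hA, if_neg h, if_neg fun h' : IsEdge 𝒯 j i => h h'.symm]
      ring
  have hK : ∑ i, C.Kv (f 0) i * deriv (fun t => f t i) 0 = ∑ i, ∑ j, A i j := by
    simp only [Kv, Finset.sum_mul, ite_mul, zero_mul, hA]
  simp only [hsplit, Finset.sum_sub_distrib, Finset.sum_add_distrib]
  rw [sum_len_mul_deriv_angSum hf hx, hK, Finset.sum_comm (f := fun i j => A j i)]
  ring
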